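/- (Theorem 4, convergence) Suppose m_k < C for all k, and let (λ*, v*) be a solution of the multiplicative Bellman optimality equation (λ* = e^{Λ̃*}). Then the MPI bounds converge: lim_{n→∞} u_n = lim_{n→∞} ℓ_n = λ*. -/

import Mathlib

open Filter Topology

/-- Bellman operator of a policy `f`. -/
noncomputable def Tpol {S A : Type*} [Fintype S]
    (Q : S → A → S → ℝ) (d : S → A → ℝ) (α : ℝ) (f : S → A) (v : S → ℝ) (i : S) : ℝ :=
  Real.exp (α * d i (f i)) * ∑ j, Q i (f i) j * v j

/-- Bellman optimality operator. -/
noncomputable def Topt {S A : Type*} [Fintype S] [Nonempty A]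
    (Q : S → A → S → ℝ) (d : S → A → ℝ) (α : ℝ) (v : S → ℝ) (i : S) : ℝ :=
  ⨅ a : A, Real.exp (α * d i a) * ∑ j, Q i a j * v j

/-- The stochastic matrix of a policy `f`: `(Q_f)(i,j) = Q(j|i,f(i))`. -/
def policyMatrix {S A : Type*} (Q : S → A → S → ℝ) (f : S → A) : Matrix S S ℝ :=
  Matrix.of fun i j => Q i (f i) j

section BellmanOperators

variable {S A : Type*} [Fintype S] {Q : S → A → S → ℝ} {d : S → A → ℝ} {α : ℝ}

lemma Tpol_mono (hQ0 : ∀ i a j, 0 ≤ Q i a j) (f : S → A) {v w : S → ℝ} (h : v ≤ w) :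
    Tpol Q d α f v ≤ Tpol Q d α f w := fun i =>
  mul_le_mul_of_nonneg_left
    (Finset.sum_le_sum fun j _ => mul_le_mul_of_nonneg_left (h j) (hQ0 i (f i) j))
    (Real.exp_pos _).le

lemma Tpol_smul (f : S → A) (c : ℝ) (v : S → ℝ) :
    Tpol Q d α f (c • v) = c • Tpol Q d α f v := by
  funext i
  simp only [Tpol, Pi.smul_apply, smul_eq_mul, Finset.mul_sum]
  exact Finset.sum_congr rfl fun j _ => by ring

lemma Tpol_sub (f : S → A) (v w : S → ℝ) :
    Tpol Q d α f (v - w) = Tpol Q d α f v - Tpol Q d α f w := by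
  funext i
  simp only [Tpol, Pi.sub_apply, mul_sub, Finset.sum_sub_distrib]

lemma Tpol_nonneg (hQ0 : ∀ i a j, 0 ≤ Q i a j) (f : S → A) {v : S → ℝ} (hv : 0 ≤ v) :
    0 ≤ Tpol Q d α f v := fun i =>
  mul_nonneg (Real.exp_pos _).le (Finset.sum_nonneg fun j _ => mul_nonneg (hQ0 i (f i) j) (hv j))

lemma Tpol_iterate_smul (f : S → A) (c : ℝ) (m : ℕ) (v : S → ℝ) :
    (Tpol Q d α f)^[m] (c • v) = c • (Tpol Q d α f)^[m] v := by
  induction m generalizing v with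
  | zero => rfl
  | succ m ih => rw [Function.iterate_succ_apply, Tpol_smul, ih, Function.iterate_succ_apply]

lemma Tpol_iterate_sub (f : S → A) (m : ℕ) (v w : S → ℝ) :
    (Tpol Q d α f)^[m] (v - w) = (Tpol Q d α f)^[m] v - (Tpol Q d α f)^[m] w := by
  induction m generalizing v w with
  | zero => rfl
  | succ m ih => simp only [Function.iterate_succ_apply, Tpol_sub, ih]

lemma Tpol_iterate_le (hQ0 : ∀ i a j, 0 ≤ Q i a j) (f : S → A) {u : ℝ} (hu : 0 ≤ u)
    {v : S → ℝ} (h : Tpol Q d α f v ≤ u • v) (m : ℕ) :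
    (Tpol Q d α f)^[m] v ≤ u ^ m • v := by
  induction m with
  | zero => simp
  | succ m ih =>
    rw [Function.iterate_succ_apply']
    refine (Tpol_mono hQ0 f ih).trans ?_
    rw [Tpol_smul, pow_succ, mul_smul]
    exact smul_le_smul_of_nonneg_left h (pow_nonneg hu m)

lemma Tpol_iterate_nonneg (hQ0 : ∀ i a j, 0 ≤ Q i a j) (f : S → A) {v : S → ℝ} (hv : 0 ≤ v)
    (m : ℕ) : 0 ≤ (Tpol Q d α f)^[m] v := by
  induction m with
  | zero => exact hv
  | succ m ih =>
    rw [Function.iterate_succ_apply']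
    exact Tpol_nonneg hQ0 f ih

/-- A single positive entry of the kernel gives a lower bound for the Bellman operator. -/
lemma mul_le_Tpol (hQ0 : ∀ i a j, 0 ≤ Q i a j) {η : ℝ}
    (hη : ∀ i a j, 0 < Q i a j → η ≤ Real.exp (α * d i a) * Q i a j)
    (f : S → A) {v : S → ℝ} (hv : 0 ≤ v) {i j : S} (hij : 0 < Q i (f i) j) :
    η * v j ≤ Tpol Q d α f v i :=
  calc η * v j ≤ Real.exp (α * d i (f i)) * Q i (f i) j * v j :=
        mul_le_mul_of_nonneg_right (hη _ _ _ hij) (hv j)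
    _ = Real.exp (α * d i (f i)) * (Q i (f i) j * v j) := by ring
    _ ≤ _ := mul_le_mul_of_nonneg_left
        (Finset.single_le_sum (f := fun j => Q i (f i) j * v j)
          (fun j _ => mul_nonneg (hQ0 i (f i) j) (hv j)) (Finset.mem_univ j)) (Real.exp_pos _).le

lemma pow_mul_le_Tpol_iterate (hQ0 : ∀ i a j, 0 ≤ Q i a j) (hdiag : ∀ i a, 0 < Q i a i) {η : ℝ}
    (hη0 : 0 < η) (hη : ∀ i a j, 0 < Q i a j → η ≤ Real.exp (α * d i a) * Q i a j)
    (f : S → A) {v : S → ℝ} (hv : 0 ≤ v) (m : ℕ) (i : S) :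
    η ^ m * v i ≤ (Tpol Q d α f)^[m] v i := by
  induction m with
  | zero => simp
  | succ m ih =>
    rw [Function.iterate_succ_apply', pow_succ', mul_assoc]
    exact (mul_le_mul_of_nonneg_left ih hη0.le).trans
      (mul_le_Tpol hQ0 hη f (Tpol_iterate_nonneg hQ0 f hv m) (hdiag i (f i)))

lemma exists_entry_lower_bound [Finite A] [Nonempty S] [Nonempty A]
    (Q : S → A → S → ℝ) (d : S → A → ℝ) (α : ℝ) :
    ∃ η : ℝ, 0 < η ∧ η ≤ 1 ∧ ∀ i a j, 0 < Q i a j → η ≤ Real.exp (α * d i a) * Q i a j := by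
  classical
  let g : S × A × S → ℝ := fun p =>
    if 0 < Q p.1 p.2.1 p.2.2 then Real.exp (α * d p.1 p.2.1) * Q p.1 p.2.1 p.2.2 else 1
  have hg : ∀ p, 0 < g p := fun p => by
    dsimp only [g]
    split_ifs with h
    · exact mul_pos (Real.exp_pos _) h
    · exact one_pos
  obtain ⟨p, hp⟩ := Finite.exists_min g
  refine ⟨min (g p) 1, lt_min (hg p) one_pos, min_le_right _ _, fun i a j h => ?_⟩
  refine (min_le_left _ _).trans ((hp (i, a, j)).trans (le_of_eq ?_))
  simp only [g, if_pos h]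

/-- An irreducible policy matrix has an edge entering any nonempty proper set of states. -/
lemma exists_edge_into [DecidableEq S] (hQ0 : ∀ i a j, 0 ≤ Q i a j) {f : S → A}
    (hirr : ∀ i j : S, ∃ k : ℕ, 1 ≤ k ∧ 0 < ((policyMatrix Q f) ^ k) i j)
    {E : Finset S} (hne : E.Nonempty) (hE : E ≠ Finset.univ) :
    ∃ i ∉ E, ∃ j ∈ E, 0 < Q i (f i) j := by
  by_contra! hcon
  have hzero : ∀ i ∉ E, ∀ j ∈ E, Q i (f i) j = 0 := fun i hi j hj =>
    le_antisymm (hcon i hi j hj) (hQ0 _ _ _)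
  have hpow : ∀ k : ℕ, ∀ i ∉ E, ∀ j ∈ E, ((policyMatrix Q f) ^ k) i j = 0 := by
    intro k
    induction k with
    | zero =>
      intro i hi j hj
      rw [pow_zero, Matrix.one_apply_ne]
      rintro rfl
      exact hi hj
    | succ k ih =>
      intro i hi j hj
      rw [pow_succ, Matrix.mul_apply]
      refine Finset.sum_eq_zero fun x _ => ?_
      by_cases hx : x ∈ E
      · rw [ih i hi x hx, zero_mul]
      · rw [policyMatrix, Matrix.of_apply, hzero x hx j hj, mul_zero]
  obtain ⟨j, hj⟩ := hne
  obtain ⟨i, hi⟩ : ∃ i, i ∉ E := by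
    by_contra! h
    exact hE (Finset.eq_univ_iff_forall.2 h)
  obtain ⟨k, -, hk⟩ := hirr i j
  exact hk.ne' (hpow k i hi j hj)

/-- Mass at one state spreads to all states within `Fintype.card S` applications of Bellman
operators, even when the policies vary from step to step. -/
lemma spread [DecidableEq S] (hQ0 : ∀ i a j, 0 ≤ Q i a j) (hdiag : ∀ i a, 0 < Q i a i)
    (hirr : ∀ f : S → A, ∀ i j : S, ∃ k : ℕ, 1 ≤ k ∧ 0 < ((policyMatrix Q f) ^ k) i j)
    {η : ℝ} (hη0 : 0 < η) (hη : ∀ i a j, 0 < Q i a j → η ≤ Real.exp (α * d i a) * Q i a j)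
    {c : ℝ} (hc : 0 < c) (y : ℕ → S → ℝ) (hy : ∀ k, 0 ≤ y k) (F : ℕ → S → A)
    (hstep : ∀ k i, c * Tpol Q d α (F k) (y k) i ≤ y (k + 1) i) (i j : S) :
    (c * η) ^ Fintype.card S * y 0 j ≤ y (Fintype.card S) i := by
  have key : ∀ k : ℕ, ∃ E : Finset S, min (k + 1) (Fintype.card S) ≤ E.card ∧
      ∀ x ∈ E, (c * η) ^ k * y 0 j ≤ y k x := by
    intro k
    induction k with
    | zero => exact ⟨{j}, by simp, by simp⟩
    | succ k ih =>
      obtain ⟨E, hcard, hE⟩ := ih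
      have hadvance : ∀ x, ∀ e ∈ E, 0 < Q x (F k x) e →
          (c * η) ^ (k + 1) * y 0 j ≤ y (k + 1) x := fun x e he hxe =>
        calc (c * η) ^ (k + 1) * y 0 j = (c * η) * ((c * η) ^ k * y 0 j) := by ring
          _ ≤ (c * η) * y k e := mul_le_mul_of_nonneg_left (hE e he) (mul_pos hc hη0).le
          _ = c * (η * y k e) := by ring
          _ ≤ c * Tpol Q d α (F k) (y k) x :=
              mul_le_mul_of_nonneg_left (mul_le_Tpol hQ0 hη _ (hy k) hxe) hc.le
          _ ≤ _ := hstep k x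
      by_cases huniv : E = Finset.univ
      · refine ⟨E, ?_, fun x hx => hadvance x x hx (hdiag _ _)⟩
        rw [huniv, Finset.card_univ]
        exact min_le_right _ _
      · have hpos : 0 < Fintype.card S := Fintype.card_pos_iff.2 ⟨j⟩
        have hne : E.Nonempty := Finset.card_pos.1 (by omega)
        obtain ⟨x, hx, e, he, hxe⟩ := exists_edge_into hQ0 (hirr (F k)) hne huniv
        refine ⟨insert x E, ?_, fun z hz => ?_⟩
        · rw [Finset.card_insert_of_notMem hx]
          omega
        · rcases Finset.mem_insert.1 hz with rfl | hz
          · exact hadvance _ e he hxe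
          · exact hadvance z z hz (hdiag _ _)
  obtain ⟨E, hcard, hE⟩ := key (Fintype.card S)
  have huniv : E = Finset.univ :=
    (Finset.card_eq_iff_eq_univ E).1 (le_antisymm (Finset.card_le_univ E) (by omega))
  exact hE i (huniv ▸ Finset.mem_univ i)

variable [Nonempty A]

lemma Topt_smul {c : ℝ} (hc : 0 ≤ c) (v : S → ℝ) :
    Topt Q d α (c • v) = c • Topt Q d α v := by
  funext i
  simp only [Topt, Pi.smul_apply, smul_eq_mul]
  rw [Real.mul_iInf_of_nonneg hc]
  refine congrArg _ (funext fun a => ?_)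
  simp only [Finset.mul_sum]
  exact Finset.sum_congr rfl fun j _ => by ring

variable [Finite A]

lemma Topt_le_Tpol (f : S → A) (v : S → ℝ) : Topt Q d α v ≤ Tpol Q d α f v := fun i =>
  ciInf_le (Set.finite_range _).bddBelow (f i)

lemma Topt_mono (hQ0 : ∀ i a j, 0 ≤ Q i a j) {v w : S → ℝ} (h : v ≤ w) :
    Topt Q d α v ≤ Topt Q d α w := fun i =>
  ciInf_mono (Set.finite_range _).bddBelow fun a =>
    mul_le_mul_of_nonneg_left
      (Finset.sum_le_sum fun j _ => mul_le_mul_of_nonneg_left (h j) (hQ0 i a j))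
      (Real.exp_pos _).le

/-- A solution of the optimality equation is bounded above by any upper Collatz–Wielandt bound. -/
lemma eigenvalue_le_of_Topt_le [Nonempty S] (hQ0 : ∀ i a j, 0 ≤ Q i a j) {r u : ℝ}
    {w v : S → ℝ} (hw : ∀ i, 0 < w i) (hv : ∀ i, 0 < v i) (hopt : Topt Q d α w = r • w)
    (h : Topt Q d α v ≤ u • v) : r ≤ u := by
  obtain ⟨i, hi⟩ := Finite.exists_min fun i => v i / w i
  have hκ : 0 < v i / w i := div_pos (hv i) (hw i)
  have hle : (v i / w i) • w ≤ v := fun j => (le_div_iff₀ (hw j)).1 (hi j)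
  have h1 := Topt_mono (d := d) (α := α) hQ0 hle i
  rw [Topt_smul hκ.le, hopt] at h1
  have h2 := h i
  simp only [Pi.smul_apply, smul_eq_mul] at h1 h2
  have h3 : v i / w i * (r * w i) = r * v i := by field_simp [(hw i).ne']
  exact le_of_mul_le_mul_right ((h3.symm.le.trans h1).trans h2) (hv i)

/-- A solution of the optimality equation is bounded below by any lower Collatz–Wielandt bound. -/
lemma le_eigenvalue_of_le_Topt [Nonempty S] (hQ0 : ∀ i a j, 0 ≤ Q i a j) {r l : ℝ}
    {w v : S → ℝ} (hw : ∀ i, 0 < w i) (hv : ∀ i, 0 < v i) (hopt : Topt Q d α w = r • w)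
    (h : l • v ≤ Topt Q d α v) : l ≤ r := by
  obtain ⟨i, hi⟩ := Finite.exists_max fun i => v i / w i
  have hκ : 0 < v i / w i := div_pos (hv i) (hw i)
  have hle : v ≤ (v i / w i) • w := fun j => (div_le_iff₀ (hw j)).1 (hi j)
  have h1 := Topt_mono (d := d) (α := α) hQ0 hle i
  rw [Topt_smul hκ.le, hopt] at h1
  have h2 := h i
  simp only [Pi.smul_apply, smul_eq_mul] at h1 h2
  have h3 : v i / w i * (r * w i) = r * v i := by field_simp [(hw i).ne']
  exact le_of_mul_le_mul_right ((h2.trans h1).trans h3.le) (hv i)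

/-- The slack `u v - T v` after a policy evaluation step dominates the evaluated slack. -/
lemma Tpol_iterate_slack_le {f : S → A} {v : S → ℝ}
    (hf : Tpol Q d α f v = Topt Q d α v) {s : ℝ} (hs : 0 < s) (m : ℕ) (u : ℝ) :
    s⁻¹ • (Tpol Q d α f)^[m] (u • v - Topt Q d α v) ≤
      u • s⁻¹ • (Tpol Q d α f)^[m] v - Topt Q d α (s⁻¹ • (Tpol Q d α f)^[m] v) := by
  have h := Topt_le_Tpol (Q := Q) (d := d) (α := α) f ((Tpol Q d α f)^[m] v)
  rw [Topt_smul (inv_pos.2 hs).le, ← hf, Tpol_iterate_sub, Tpol_iterate_smul,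
    ← Function.iterate_succ_apply, Function.iterate_succ_apply', smul_comm u, ← smul_sub]
  exact smul_le_smul_of_nonneg_left (sub_le_sub_left h _) (inv_pos.2 hs).le

end BellmanOperators


/-- Theorem 4 (convergence): if `m_k < C` for all `k` and `(λ*, v*)` solves the
multiplicative Bellman optimality equation, then `u_n → λ*` and `ℓ_n → λ*`. -/
theorem mpi_convergence
    {S A : Type*} [Fintype S] [Fintype A] [Nonempty S] [Nonempty A] [DecidableEq S]
    (Q : S → A → S → ℝ) (d : S → A → ℝ) (α : ℝ) (hα : 0 < α)
    (hQ0 : ∀ i a j, 0 ≤ Q i a j) (hQ1 : ∀ i a, ∑ j, Q i a j = 1)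
    (hdiag : ∀ i a, 0 < Q i a i)
    (hirr : ∀ f : S → A, ∀ i j : S, ∃ k : ℕ, 1 ≤ k ∧ 0 < ((policyMatrix Q f) ^ k) i j)
    (m : ℕ → ℕ) (hm : ∀ k, 1 ≤ m k) (C : ℕ) (hC : ∀ k, m k < C)
    (lamStar : ℝ) (vStar : S → ℝ)
    (hlamStar : 0 < lamStar) (hvStar : ∀ i, 0 < vStar i)
    (hopt : ∀ i, lamStar * vStar i = Topt Q d α vStar i)
    (v' : ℕ → S → ℝ) (f : ℕ → S → A)
    (hv0pos : ∀ i, 0 < v' 0 i) (hv0sum : ∑ i, v' 0 i = 1)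
    (hgreedy : ∀ k i, Tpol Q d α (f (k + 1)) (v' k) i = Topt Q d α (v' k) i)
    (hstep : ∀ k i, v' (k + 1) i =
      (Tpol Q d α (f (k + 1)))^[m k] (v' k) i /
        ∑ j, (Tpol Q d α (f (k + 1)))^[m k] (v' k) j) :
    Tendsto (fun n => ⨆ i, Topt Q d α (v' n) i / v' n i) atTop (𝓝 lamStar) ∧
      Tendsto (fun n => ⨅ i, Topt Q d α (v' n) i / v' n i) atTop (𝓝 lamStar) := by
  obtain ⟨η, hη0, hη1, hη⟩ := exists_entry_lower_bound Q d α
  set N := Fintype.card S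
  have hN : (0 : ℝ) < N := Nat.cast_pos.2 Fintype.card_pos
  have hgr : ∀ k, Tpol Q d α (f (k + 1)) (v' k) = Topt Q d α (v' k) := fun k =>
    funext (hgreedy k)
  have hopt' : Topt Q d α vStar = lamStar • vStar := funext fun i => (hopt i).symm
  set s : ℕ → ℝ := fun k => ∑ j, (Tpol Q d α (f (k + 1)))^[m k] (v' k) j
  have hvs : ∀ k, v' (k + 1) = (s k)⁻¹ • (Tpol Q d α (f (k + 1)))^[m k] (v' k) := fun k =>
    funext fun i => by
      rw [hstep k i, Pi.smul_apply, smul_eq_mul, div_eq_inv_mul]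
  have hit : ∀ k, (∀ i, 0 < v' k i) →
      ∀ i, 0 < (Tpol Q d α (f (k + 1)))^[m k] (v' k) i := fun k hk i =>
    (mul_pos (pow_pos hη0 _) (hk i)).trans_le
      (pow_mul_le_Tpol_iterate hQ0 hdiag hη0 hη _ (fun j => (hk j).le) _ i)
  have hs_of : ∀ k, (∀ i, 0 < v' k i) → 0 < s k := fun k hk =>
    Finset.sum_pos (fun i _ => hit k hk i) Finset.univ_nonempty
  have hvpos : ∀ k i, 0 < v' k i := by
    intro k
    induction k with
    | zero => exact hv0pos
    | succ k ih =>
      intro i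
      rw [hstep k i]
      exact div_pos (hit k ih i) (hs_of k ih)
  have hspos : ∀ k, 0 < s k := fun k => hs_of k (hvpos k)
  have hvsum : ∀ k, ∑ i, v' k i = 1 := by
    intro k
    cases k with
    | zero => exact hv0sum
    | succ k =>
      rw [hvs]
      simp only [Pi.smul_apply, smul_eq_mul, ← Finset.mul_sum]
      exact inv_mul_cancel₀ (hspos k).ne'
  have hvle : ∀ k i, v' k i ≤ 1 := fun k i =>
    hvsum k ▸ Finset.single_le_sum (fun j _ => (hvpos k j).le) (Finset.mem_univ i)
  set u : ℕ → ℝ := fun n => ⨆ i, Topt Q d α (v' n) i / v' n i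
  set l : ℕ → ℝ := fun n => ⨅ i, Topt Q d α (v' n) i / v' n i
  have hTu : ∀ n, Topt Q d α (v' n) ≤ u n • v' n := fun n i =>
    (div_le_iff₀ (hvpos n i)).1
      (le_ciSup (f := fun i => Topt Q d α (v' n) i / v' n i) (Set.finite_range _).bddAbove i)
  have hTl : ∀ n, l n • v' n ≤ Topt Q d α (v' n) := fun n i =>
    (le_div_iff₀ (hvpos n i)).1
      (ciInf_le (f := fun i => Topt Q d α (v' n) i / v' n i) (Set.finite_range _).bddBelow i)
  have hlam_u : ∀ n, lamStar ≤ u n := fun n =>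
    eigenvalue_le_of_Topt_le hQ0 hvStar (hvpos n) hopt' (hTu n)
  have hl_lam : ∀ n, l n ≤ lamStar := fun n =>
    le_eigenvalue_of_le_Topt hQ0 hvStar (hvpos n) hopt' (hTl n)
  have hslack : ∀ (r : ℝ) (k : ℕ),
      (s k)⁻¹ • (Tpol Q d α (f (k + 1)))^[m k] (r • v' k - Topt Q d α (v' k)) ≤
        r • v' (k + 1) - Topt Q d α (v' (k + 1)) := fun r k => by
    rw [hvs k]
    exact Tpol_iterate_slack_le (hgr k) (hspos k) (m k) r
  have hanti : Antitone u := antitone_nat_of_succ_le fun n => by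
    refine ciSup_le fun i => (div_le_iff₀ (hvpos _ i)).2 ?_
    have h0 := Tpol_iterate_nonneg (d := d) (α := α) hQ0 (f (n + 1))
      (sub_nonneg.2 (hTu n)) (m n)
    have h1 := (smul_nonneg (inv_pos.2 (hspos n)).le h0).trans (hslack (u n) n)
    exact sub_nonneg.1 h1 i
  have hu0 : ∀ n, 0 < u n := fun n => hlamStar.trans_le (hlam_u n)
  set κ : ℝ := ((u 0)⁻¹ * η) ^ N / N
  have hκ0 : 0 < κ := div_pos (pow_pos (mul_pos (inv_pos.2 (hu0 0)) hη0) _) hN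
  have hvlow : ∀ n i, κ ≤ v' n i := by
    intro n i
    have h := spread (d := d) (α := α) hQ0 hdiag hirr hη0 hη (inv_pos.2 (hu0 0))
      (fun _ => v' n) (fun _ j => (hvpos n j).le) (fun _ => f (n + 1)) (fun _ j => by
        rw [hgr n, inv_mul_le_iff₀ (hu0 0)]
        exact (hTu n j).trans (mul_le_mul_of_nonneg_right (hanti (Nat.zero_le n)) (hvpos n j).le)) i
    have hsum := Finset.sum_le_sum fun j (_ : j ∈ Finset.univ) => h j
    rw [← Finset.mul_sum, hvsum, mul_one, Finset.sum_const, Finset.card_univ, nsmul_eq_mul] at hsum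
    exact (div_le_iff₀' hN).2 hsum
  set D : ℝ := max 1 (u 0) ^ C
  have hD0 : 0 < D := pow_pos (one_pos.trans_le (le_max_left _ _)) _
  have hsD : ∀ k, s k ≤ D := by
    intro k
    have h := Tpol_iterate_le hQ0 (f (k + 1)) (hu0 k).le ((hgr k).le.trans (hTu k)) (m k)
    calc s k ≤ ∑ j, u k ^ m k * v' k j := Finset.sum_le_sum fun j _ => h j
      _ = u k ^ m k := by rw [← Finset.mul_sum, hvsum, mul_one]
      _ ≤ max 1 (u 0) ^ m k :=
          pow_le_pow_left₀ (hu0 k).le ((hanti (Nat.zero_le k)).trans (le_max_right _ _)) _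
      _ ≤ D := pow_le_pow_right₀ (le_max_left _ _) (hC k).le
  set c : ℝ := D⁻¹ * η ^ C with hc
  have hc0 : 0 < c := mul_pos (inv_pos.2 hD0) (pow_pos hη0 _)
  have hslack_low : ∀ n k, 0 ≤ u n • v' (n + k) - Topt Q d α (v' (n + k)) := fun n k =>
    sub_nonneg.2 ((hTu (n + k)).trans fun i =>
      mul_le_mul_of_nonneg_right (hanti (Nat.le_add_right n k)) (hvpos _ i).le)
  have hcontr : ∀ n, (c * η) ^ N * κ * (u n - l n) ≤ u n - u (n + N) := by
    intro n
    obtain ⟨i, hi⟩ := exists_eq_ciSup_of_finite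
      (f := fun i => Topt Q d α (v' (n + N)) i / v' (n + N) i)
    obtain ⟨j, hj⟩ := exists_eq_ciInf_of_finite (f := fun i => Topt Q d α (v' n) i / v' n i)
    have hi' : Topt Q d α (v' (n + N)) i = u (n + N) * v' (n + N) i :=
      (div_eq_iff (hvpos _ i).ne').1 hi
    have hj' : Topt Q d α (v' n) j = l n * v' n j := (div_eq_iff (hvpos _ j).ne').1 hj
    have h := spread (d := d) (α := α) hQ0 hdiag hirr hη0 hη hc0
      (fun k => u n • v' (n + k) - Topt Q d α (v' (n + k))) (hslack_low n)
      (fun k => f (n + k + 1)) (fun k x => by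
        refine le_trans ?_ (hslack (u n) (n + k) x)
        set z := u n • v' (n + k) - Topt Q d α (v' (n + k))
        have hz0 : 0 ≤ z := hslack_low n k
        have hTz := Tpol_nonneg (d := d) (α := α) hQ0 (f (n + k + 1)) hz0
        obtain ⟨p, hp⟩ : ∃ p, m (n + k) = p + 1 := ⟨m (n + k) - 1, by have := hm (n + k); omega⟩
        have hpC : p ≤ C := by have := hC (n + k); omega
        rw [Pi.smul_apply, smul_eq_mul, hp, Function.iterate_succ_apply, hc, mul_assoc]
        refine mul_le_mul (inv_anti₀ (hspos _) (hsD _)) ?_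
          (mul_nonneg (pow_pos hη0 _).le (hTz x)) (inv_pos.2 (hspos _)).le
        exact (mul_le_mul_of_nonneg_right (pow_le_pow_of_le_one hη0.le hη1 hpC) (hTz x)).trans
          (pow_mul_le_Tpol_iterate hQ0 hdiag hη0 hη _ hTz p x)) i j
    simp only [Pi.sub_apply, Pi.smul_apply, smul_eq_mul, add_zero] at h
    rw [hi', hj', ← sub_mul, ← sub_mul] at h
    have hr : 0 ≤ (c * η) ^ N := (pow_pos (mul_pos hc0 hη0) _).le
    have hul : 0 ≤ u n - l n := sub_nonneg.2 ((hl_lam n).trans (hlam_u n))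
    have huu : 0 ≤ u n - u (n + N) := sub_nonneg.2 (hanti (Nat.le_add_right n N))
    calc (c * η) ^ N * κ * (u n - l n) = (c * η) ^ N * ((u n - l n) * κ) := by ring
      _ ≤ (c * η) ^ N * ((u n - l n) * v' n j) :=
          mul_le_mul_of_nonneg_left (mul_le_mul_of_nonneg_left (hvlow n j) hul) hr
      _ ≤ (u n - u (n + N)) * v' (n + N) i := h
      _ ≤ u n - u (n + N) := mul_le_of_le_one_right huu (hvle _ i)
  set ρ : ℝ := (c * η) ^ N * κ
  have hρ0 : 0 < ρ := mul_pos (pow_pos (mul_pos hc0 hη0) _) hκ0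
  have hlim : Tendsto u atTop (𝓝 (⨅ n, u n)) :=
    tendsto_atTop_ciInf hanti ⟨lamStar, by rintro _ ⟨n, rfl⟩; exact hlam_u n⟩
  have hgap : Tendsto (fun n => (u n - u (n + N)) / ρ) atTop (𝓝 0) := by
    simpa using (hlim.sub (hlim.comp (tendsto_add_atTop_nat N))).div_const ρ
  have hbound : ∀ n, u n - l n ≤ (u n - u (n + N)) / ρ := fun n =>
    (le_div_iff₀' hρ0).2 (hcontr n)
  constructor
  · refine tendsto_of_tendsto_of_tendsto_of_le_of_le tendsto_const_nhds
      (by simpa using hgap.const_add lamStar) hlam_u fun n => ?_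
    have h1 := hbound n
    have h2 := hl_lam n
    dsimp only
    linarith
  · refine tendsto_of_tendsto_of_tendsto_of_le_of_le (by simpa using hgap.const_sub lamStar)
      tendsto_const_nhds (fun n => ?_) hl_lam
    have h1 := hbound n
    have h2 := hlam_u n
    dsimp only
    linarith
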